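/- If T is a closed operator, and M, N are unbounded normal operators with dom(N) ⊆ dom(TN) ⊆ dom(T), then TN ⊆ MT implies TN* ⊆ M*T. -/

import Mathlib

open LinearPMap

/-- Composition of partial linear maps: `T.pcomp S` is "first `S`, then `T`", with
domain `{x ∈ dom S : S x ∈ dom T}`. -/
noncomputable def LinearPMap.pcomp {H : Type*} [NormedAddCommGroup H] [InnerProductSpace ℂ H]
    (T S : H →ₗ.[ℂ] H) : H →ₗ.[ℂ] H where
  domain := (Submodule.comap S.toFun T.domain).map S.domain.subtype
  toFun := T.toFun ∘ₗ (S.toFun.restrict fun _ hx => hx) ∘ₗ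
    (Submodule.equivMapOfInjective S.domain.subtype S.domain.injective_subtype
      (Submodule.comap S.toFun T.domain)).symm.toLinearMap

/-- A densely defined closed operator `N` on a complex Hilbert space is normal if
`N* N = N N*` (as partial linear maps). -/
noncomputable def LinearPMap.IsNormalOp {H : Type*} [NormedAddCommGroup H]
    [InnerProductSpace ℂ H] [CompleteSpace H] (N : H →ₗ.[ℂ] H) : Prop :=
  Dense (N.domain : Set H) ∧ N.IsClosed ∧ N.adjoint.pcomp N = N.pcomp N.adjoint

/-- A bounded everywhere-defined operator viewed as a partial linear map. -/
noncomputable def ContinuousLinearMap.toPMapTop {H : Type*} [NormedAddCommGroup H]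
    [InnerProductSpace ℂ H] (A : H →L[ℂ] H) : H →ₗ.[ℂ] H :=
  (A : H →ₗ[ℂ] H).toPMap ⊤

variable {H : Type*} [NormedAddCommGroup H] [InnerProductSpace ℂ H] [CompleteSpace H]

section FPHelpers

open Filter Topology

lemma fp_mem_pcomp_graph {H : Type*} [NormedAddCommGroup H] [InnerProductSpace ℂ H]
    (T S : H →ₗ.[ℂ] H) (x z : H) :
    (x, z) ∈ (T.pcomp S).graph ↔ ∃ y, (x, y) ∈ S.graph ∧ (y, z) ∈ T.graph := by
  have key : ∀ (a : S.domain) (ha : S a ∈ T.domain) (h : (a : H) ∈ (T.pcomp S).domain),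
      (T.pcomp S) ⟨a, h⟩ = T ⟨S a, ha⟩ := by
    intro a ha h
    have h2 : (⟨(a : H), h⟩ : (T.pcomp S).domain) =
      (Submodule.equivMapOfInjective S.domain.subtype S.domain.injective_subtype
      (Submodule.comap S.toFun T.domain)) ⟨a, ha⟩ := by
      apply Subtype.ext
      rfl
    rw [h2]
    change T.toFun ((S.toFun.restrict fun _ hx => hx)
      ((Submodule.equivMapOfInjective S.domain.subtype S.domain.injective_subtype
      (Submodule.comap S.toFun T.domain)).symm _)) = _
    rw [LinearEquiv.symm_apply_apply]
    rfl
  constructor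
  · intro h
    rw [LinearPMap.mem_graph_iff] at h
    obtain ⟨⟨y, hy⟩, h1, h2⟩ := h
    obtain ⟨a, ha, hay⟩ := id hy
    simp only at h1 h2
    subst h1
    have hay' : (a : H) = y := hay
    subst hay'
    have ha' : S a ∈ T.domain := ha
    refine ⟨S a, S.mem_graph a, ?_⟩
    rw [← h2, key a ha' hy]
    exact T.mem_graph ⟨S a, ha'⟩
  · rintro ⟨y, h1, h2⟩
    rw [LinearPMap.mem_graph_iff] at h1 h2
    obtain ⟨a, ha, hb⟩ := h1
    obtain ⟨b, hc, hd⟩ := h2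
    simp only at ha hb hc hd
    subst ha
    subst hd
    have hm : S a ∈ T.domain := by rw [hb, ← hc]; exact b.2
    have hdom : (a : H) ∈ (T.pcomp S).domain := ⟨a, hm, rfl⟩
    have : b = ⟨S a, hm⟩ := Subtype.ext (by simp [hb, hc])
    rw [this, ← key a hm hdom]
    exact (T.pcomp S).mem_graph ⟨a, hdom⟩

lemma fp_adj {H : Type*} [NormedAddCommGroup H] [InnerProductSpace ℂ H] [CompleteSpace H]
    {N : H →ₗ.[ℂ] H} (hN : Dense (N.domain : Set H)) (c d : H) :
    (c, d) ∈ N.adjoint.graph ↔ ∀ a b, (a, b) ∈ N.graph → inner ℂ b c = inner ℂ a d := by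
  rw [LinearPMap.adjoint_graph_eq_graph_adjoint hN, Submodule.mem_adjoint_iff]
  simp only [sub_eq_zero]

lemma fp_resolvent {H : Type*} [NormedAddCommGroup H] [InnerProductSpace ℂ H] [CompleteSpace H]
    {N : H →ₗ.[ℂ] H} (hd : Dense (N.domain : Set H)) (hc : N.IsClosed) :
    ∃ R Z : H →L[ℂ] H, IsSelfAdjoint R ∧ (∀ x, (R x, Z x) ∈ N.graph) ∧
      (∀ x, (Z x, x - R x) ∈ N.adjoint.graph) := by
  let e := WithLp.prodContinuousLinearEquiv 2 ℂ H H
  let G : Submodule ℂ (WithLp 2 (H × H)) := N.graph.comap (e : WithLp 2 (H × H) →ₗ[ℂ] H × H)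
  have hG : IsClosed (G : Set (WithLp 2 (H × H))) := hc.preimage e.continuous
  have : CompleteSpace G := hG.completeSpace_coe
  let P := G.starProjection
  let i : H →L[ℂ] WithLp 2 (H × H) :=
    (e.symm : H × H →L[ℂ] WithLp 2 (H × H)) ∘L ContinuousLinearMap.inl ℂ H H
  let R : H →L[ℂ] H := ContinuousLinearMap.fst ℂ H H ∘L (e : WithLp 2 (H × H) →L[ℂ] H × H) ∘L P ∘L i
  let Z : H →L[ℂ] H := ContinuousLinearMap.snd ℂ H H ∘L (e : WithLp 2 (H × H) →L[ℂ] H × H) ∘L P ∘L i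
  have hPmem : ∀ x, P (i x) ∈ G := fun x => Submodule.starProjection_apply_mem G (i x)
  have h1 : ∀ x, (R x, Z x) ∈ N.graph := fun x => hPmem x
  have hinn : ∀ (w : WithLp 2 (H × H)) (y : H), inner ℂ w (i y) = inner ℂ (e w).1 y := by
    intro w y
    rw [WithLp.prod_inner_apply]
    simp [i, e]
  refine ⟨R, Z, ?_, h1, ?_⟩
  · rw [ContinuousLinearMap.isSelfAdjoint_iff_isSymmetric]
    intro x y
    have ha : inner ℂ (R x) y = inner ℂ (P (i x)) (i y) := (hinn _ _).symm
    have hb : inner ℂ (R y) x = inner ℂ (P (i y)) (i x) := (hinn _ _).symm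
    have hb' : inner ℂ x (R y) = inner ℂ (i x) (P (i y)) := by
      rw [← inner_conj_symm, hb, inner_conj_symm]
    change inner ℂ (R x) y = inner ℂ x (R y)
    rw [ha, hb']
    exact Submodule.inner_starProjection_left_eq_right G _ _
  · intro x
    rw [fp_adj hd]
    intro a b hab
    have h := Submodule.starProjection_inner_eq_zero (K := G) (i x) (e.symm (a, b))
      (by change e (e.symm (a, b)) ∈ N.graph; simpa using hab)
    rw [WithLp.prod_inner_apply] at h
    have e1 : (i x - P (i x)).fst = x - R x := by
      simp [i, e, R]
    have e2 : (i x - P (i x)).snd = - Z x := by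
      simp [i, e, Z]
    have h' : inner ℂ (x - R x) a + inner ℂ (- Z x) b = 0 := by
      rw [← e1, ← e2]; exact h
    rw [inner_neg_left, add_neg_eq_zero] at h'
    rw [← inner_conj_symm, ← h', inner_conj_symm]

lemma fp_normal {H : Type*} [NormedAddCommGroup H] [InnerProductSpace ℂ H] [CompleteSpace H]
    {N : H →ₗ.[ℂ] H} (hN : N.IsNormalOp) :
    ∃ R Z : H →L[ℂ] H, IsSelfAdjoint R ∧ IsStarNormal Z ∧ Commute R Z ∧
      (∀ x, R x = 0 → x = 0) ∧
      (∀ a b, (a, b) ∈ N.graph ↔ Z a = R b) ∧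
      (∀ a b, (a, b) ∈ N.adjoint.graph ↔ (star Z) a = R b) ∧
      (∀ x, ∃ p q r, (p, q) ∈ N.graph ∧ (r, x - p) ∈ N.graph) := by
  obtain ⟨hd, hc, hn⟩ := hN
  obtain ⟨R, Z, hR, F1, F2⟩ := fp_resolvent hd hc
  have hRs : ∀ x y, inner ℂ (R x) y = inner ℂ x (R y) :=
    (ContinuousLinearMap.isSelfAdjoint_iff_isSymmetric.mp hR)
  have hZs : ∀ x y, inner ℂ ((star Z) x) y = inner ℂ x (Z y) := fun x y =>
    ContinuousLinearMap.adjoint_inner_left Z y x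
  have hZs' : ∀ x y, inner ℂ x ((star Z) y) = inner ℂ (Z x) y := fun x y =>
    ContinuousLinearMap.adjoint_inner_right Z x y
  have adj : ∀ {a b c d : H}, (a, b) ∈ N.graph → (c, d) ∈ N.adjoint.graph →
      inner ℂ b c = inner ℂ a d := fun h1 h2 => (fp_adj hd _ _).1 h2 _ _ h1
  have adj' : ∀ {a b c d : H}, (a, b) ∈ N.graph → (c, d) ∈ N.adjoint.graph →
      inner ℂ c b = inner ℂ d a := fun h1 h2 => by
    rw [← inner_conj_symm, adj h1 h2, inner_conj_symm]
  have F34 : ∀ x, (R x, (star Z) x) ∈ N.adjoint.graph ∧ ((star Z) x, x - R x) ∈ N.graph := by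
    intro x
    have : (R x, x - R x) ∈ (N.adjoint.pcomp N).graph :=
      (fp_mem_pcomp_graph _ _ _ _).2 ⟨Z x, F1 x, F2 x⟩
    rw [hn] at this
    obtain ⟨w, hw1, hw2⟩ := (fp_mem_pcomp_graph _ _ _ _).1 this
    have hw : (star Z) x = w := by
      apply ext_inner_left ℂ
      intro u
      rw [hZs']
      have e1 := adj (F1 u) hw1
      have e2 := adj' hw2 (F2 u)
      rw [inner_sub_right, inner_sub_left] at e2
      linear_combination e1 + e2
    rw [hw]
    exact ⟨hw1, hw2⟩
  have F3 := fun x => (F34 x).1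
  have F4 := fun x => (F34 x).2
  have G1 : ∀ a b, (a, b) ∈ N.graph → Z a = R b := by
    intro a b h
    apply ext_inner_right ℂ
    intro u
    rw [hRs, adj h (F3 u), hZs']
  have G2 : ∀ a b, (a, b) ∈ N.adjoint.graph → (star Z) a = R b := by
    intro a b h
    apply ext_inner_right ℂ
    intro u
    rw [hRs, hZs, adj' (F1 u) h]
  refine ⟨R, Z, hR, ⟨?_⟩, ?_, ?_, ?_, ?_, ?_⟩
  · ext x
    have h1 := G2 _ _ (F2 x)
    have h2 := G1 _ _ (F4 x)
    exact h1.trans h2.symm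
  · ext x
    exact (G1 _ _ (F1 x)).symm
  · intro x hx
    have h1 := F1 x
    have h2 := F2 x
    have hz : Z x = 0 := N.graph_fst_eq_zero_snd h1 hx
    have := N.adjoint.graph_fst_eq_zero_snd h2 hz
    rwa [hx, sub_zero] at this
  · intro a b
    refine ⟨G1 a b, fun h => ?_⟩
    have h1 : a - R a = (star Z) b :=
      N.adjoint.mem_graph_snd_inj (F2 a) (F3 b) h
    have h2 := N.graph.add_mem (F1 a) (F4 b)
    rw [Prod.mk_add_mk, ← h1, h] at h2
    simpa using h2
  · intro a b
    refine ⟨G2 a b, fun h => ?_⟩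
    have h1 : a - R a = Z b :=
      N.mem_graph_snd_inj (F4 a) (F1 b) h
    have h2 := N.adjoint.graph.add_mem (F3 a) (F2 b)
    rw [Prod.mk_add_mk, ← h1, h] at h2
    simpa using h2
  · intro x
    exact ⟨R x, Z x, (star Z) x, F1 x, F4 x⟩

lemma fp_cutoff {A : Type*} [CStarAlgebra A] (R : A) (hR : IsSelfAdjoint R) (ε : ℝ) (hε : 0 < ε) :
    ∃ K h : A, IsSelfAdjoint h ∧ K * h * R = K ∧ ‖K - R‖ ≤ ε ∧ Commute K R ∧ Commute K h ∧
      Commute h R ∧ (∀ Z, Commute R Z → Commute K Z) ∧ (∀ Z, Commute R Z → Commute h Z) := by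
  let k : ℝ → ℝ := fun t => t - max (-ε) (min t ε)
  let g : ℝ → ℝ := fun t => t / max (t ^ 2) (ε ^ 2)
  have hk : Continuous k := by fun_prop
  have hpos : ∀ t : ℝ, 0 < max (t ^ 2) (ε ^ 2) := fun t => lt_max_of_lt_right (by positivity)
  have hg : Continuous g := Continuous.div (by fun_prop) (by fun_prop) (fun t => (hpos t).ne')
  have hkg : ∀ t, k t * g t * t = k t := by
    intro t
    simp only [k, g]
    have hp := (hpos t).ne'
    by_cases h : |t| ≤ ε
    · rw [abs_le] at h
      rw [min_eq_left h.2, max_eq_right h.1]; simp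
    · push Not at h
      have : ε ^ 2 ≤ t ^ 2 := by rw [← sq_abs t]; gcongr
      have ht : t ≠ 0 := by rintro rfl; simp at h; linarith
      rw [max_eq_left this]
      field_simp
  refine ⟨cfc k R, cfc g R, cfc_predicate g R, ?_, ?_, ?_, cfc_commute_cfc _ _ _, ?_, ?_, ?_⟩
  · conv_lhs => rw [← cfc_mul k g R hk.continuousOn hg.continuousOn]
    conv_lhs => enter [2]; rw [← cfc_id ℝ R]
    rw [← cfc_mul _ _ R (show Continuous (fun x => k x * g x) from hk.mul hg).continuousOn continuousOn_id]
    congr 1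
    ext t
    exact hkg t
  · have : cfc k R - R = cfc (fun t => k t - t) R := by
      rw [cfc_sub k (fun t => t) R hk.continuousOn continuousOn_id, cfc_id' ℝ R]
    rw [this]
    apply norm_cfc_le hε.le
    intro t _
    simp only [k, Real.norm_eq_abs, sub_sub_cancel_left, abs_neg, abs_le]
    exact ⟨le_max_left _ _, max_le (by linarith) (min_le_right _ _)⟩
  · exact (Commute.refl R).cfc_real k
  · exact (Commute.refl R).cfc_real g
  · intro Z hZ
    exact hZ.cfc_real k
  · intro Z hZ
    exact hZ.cfc_real g

lemma fp_bounded {A : Type*} [CStarAlgebra A] (R Z S W T : A) (hR : IsSelfAdjoint R)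
    (hS : IsSelfAdjoint S) (hZ : IsStarNormal Z) (hW : IsStarNormal W) (hRZ : Commute R Z)
    (hSW : Commute S W) (h : S * T * Z = W * T * R) :
    S * (S * T * star Z) * R = S * (star W * T * R) * R := by
  have hRZ' : Commute R (star Z) := by simpa [hR.star_eq] using hRZ.star_star
  have hSW' : Commute S (star W) := by simpa [hS.star_eq] using hSW.star_star
  have main : ∀ ε : ℝ, 0 < ε → ∃ K L : A, ‖K - R‖ ≤ ε ∧ ‖L - S‖ ≤ ε ∧
      L * (S * T * star Z) * K = L * (star W * T * R) * K := by
    intro ε hε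
    obtain ⟨K, f, hf, hK1, hK2, hK3, hK4, hK5, hK6, hK7⟩ := fp_cutoff R hR ε hε
    obtain ⟨L, g, hg, hL1, hL2, hL3, hL4, hL5, hL6, hL7⟩ := fp_cutoff S hS ε hε
    refine ⟨K, L, hK2, hL2, ?_⟩
    have hfZ := (hK7 Z hRZ).eq
    have hfZ' := (hK7 _ hRZ').eq
    have hgW := (hL7 W hSW).eq
    have hgW' := (hL7 _ hSW').eq
    have hKZ := (hK6 Z hRZ).eq
    have hKZ' := (hK6 _ hRZ').eq
    have hLW := (hL6 W hSW).eq
    have hLW' := (hL6 _ hSW').eq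
    have nA : IsStarNormal (Z * f) := ⟨by
      rw [star_mul, hf.star_eq]
      change f * star Z * (Z * f) = Z * f * (f * star Z)
      have := hZ.star_comm_self.eq
      calc f * star Z * (Z * f) = f * (star Z * Z) * f := by noncomm_ring
        _ = (f * Z) * (star Z * f) := by rw [this]; noncomm_ring
        _ = _ := by rw [hfZ, ← hfZ']⟩
    have nB : IsStarNormal (W * g) := ⟨by
      rw [star_mul, hg.star_eq]
      change g * star W * (W * g) = W * g * (g * star W)
      have := hW.star_comm_self.eq
      calc g * star W * (W * g) = g * (star W * W) * g := by noncomm_ring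
        _ = (g * W) * (star W * g) := by rw [this]; noncomm_ring
        _ = _ := by rw [hgW, ← hgW']⟩
    have hX : SemiconjBy (L * T * K) (Z * f) (W * g) := by
      change L * T * K * (Z * f) = W * g * (L * T * K)
      calc L * T * K * (Z * f) = (L * g * S) * T * (K * Z) * f := by rw [hL1]; noncomm_ring
        _ = L * g * (S * T * Z) * (K * f) := by rw [hKZ]; noncomm_ring
        _ = L * (g * W) * T * (R * (K * f)) := by rw [h]; noncomm_ring
        _ = (L * W) * g * T * (K * f * R) := by
          rw [hgW, (hK3.symm.mul_right hK5.symm).eq]; noncomm_ring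
        _ = W * (L * g) * T * K := by rw [hLW, hK1]; noncomm_ring
        _ = _ := by rw [hL4.eq]; noncomm_ring
    have hX' := (hX.star_right nA nB).eq
    rw [star_mul, star_mul, hf.star_eq, hg.star_eq] at hX'
    calc L * (S * T * star Z) * K = (L * S) * T * (star Z * K) := by noncomm_ring
      _ = S * L * T * (K * f * R * star Z) := by rw [← hKZ', hL3.eq, hK1]
      _ = S * (L * T * K * (f * star Z)) * R := by
        rw [mul_assoc (K * f), hRZ'.eq]; noncomm_ring
      _ = S * (g * (star W * L)) * T * K * R := by rw [hX']; noncomm_ring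
      _ = S * ((g * L) * star W) * T * (K * R) := by rw [← hLW']; noncomm_ring
      _ = (S * (L * g)) * star W * T * (R * K) := by rw [hK3.eq, hL4.eq]; noncomm_ring
      _ = (L * g * S) * star W * T * (R * K) := by rw [(hL3.symm.mul_right hL5.symm).eq]
      _ = _ := by rw [hL1]; noncomm_ring
  choose K L hK hL hKL using fun n : ℕ => main (1 / ((n : ℝ) + 1)) (by positivity)
  have tK : Tendsto K atTop (𝓝 R) := by
    rw [tendsto_iff_norm_sub_tendsto_zero]
    exact squeeze_zero (fun _ => norm_nonneg _) hK tendsto_one_div_add_atTop_nhds_zero_nat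
  have tL : Tendsto L atTop (𝓝 S) := by
    rw [tendsto_iff_norm_sub_tendsto_zero]
    exact squeeze_zero (fun _ => norm_nonneg _) hL tendsto_one_div_add_atTop_nhds_zero_nat
  have t1 := (tL.mul_const (S * T * star Z)).mul tK
  have t2 := (tL.mul_const (star W * T * R)).mul tK
  simp only [hKL] at t1
  exact tendsto_nhds_unique t1 t2

end FPHelpers

/-- If `T` is a closed operator and `M, N` are unbounded normal operators with
`dom N ⊆ dom (T N) ⊆ dom T`, then `T N ⊆ M T` implies `T N* ⊆ M* T`. -/
theorem fuglede_putnam_closed_domTN (T N M : H →ₗ.[ℂ] H)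
    (hTc : T.IsClosed) (hTd : Dense (T.domain : Set H))
    (hN : N.IsNormalOp) (hM : M.IsNormalOp)
    (hdom1 : N.domain ≤ (T.pcomp N).domain) (hdom2 : (T.pcomp N).domain ≤ T.domain)
    (h : T.pcomp N ≤ M.pcomp T) :
    T.pcomp N.adjoint ≤ M.adjoint.pcomp T := by
  obtain ⟨R, Z, hR, hZ, hRZ, hRi, hG, hGa, hdec⟩ := fp_normal hN
  obtain ⟨S, W, hS, hW, hSW, hSi, hF, hFa, -⟩ := fp_normal hM
  have hran : ∀ a b, (a, b) ∈ N.graph → b ∈ T.domain := by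
    intro a b hab
    have h1 := hdom1 (LinearPMap.mem_domain_of_mem_graph hab)
    obtain ⟨z, hz⟩ := LinearPMap.mem_domain_iff.1 h1
    obtain ⟨y, hy1, hy2⟩ := (fp_mem_pcomp_graph _ _ _ _).1 hz
    rw [N.mem_graph_snd_inj hab hy1 rfl]
    exact LinearPMap.mem_domain_of_mem_graph hy2
  have htop : ∀ x, x ∈ T.domain := by
    intro x
    obtain ⟨p, q, r, h1, h2⟩ := hdec x
    have e1 : p ∈ T.domain := hdom2 (hdom1 (LinearPMap.mem_domain_of_mem_graph h1))
    have := T.domain.add_mem e1 (hran _ _ h2)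
    simpa using this
  let T0 : H →ₗ[ℂ] H := T.toFun ∘ₗ (LinearMap.id.codRestrict T.domain htop)
  have hT0 : ∀ x, T0 x = T ⟨x, htop x⟩ := fun x => rfl
  have hgr : T0.graph = T.graph := by
    ext ⟨x, y⟩
    rw [LinearMap.mem_graph_iff, LinearPMap.mem_graph_iff]
    constructor
    · intro hh
      exact ⟨⟨x, htop x⟩, rfl, hh.symm⟩
    · rintro ⟨⟨a, ha⟩, rfl, hh⟩
      exact hh.symm
  have hcl : IsClosed (T0.graph : Set (H × H)) := by rw [hgr]; exact hTc
  let B : H →L[ℂ] H := ContinuousLinearMap.ofIsClosedGraph hcl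
  have hB : ∀ x y, (x, y) ∈ T.graph ↔ y = B x := by
    intro x y
    rw [← hgr, LinearMap.mem_graph_iff]
    rfl
  have hid : S * B * Z = W * B * R := by
    ext u
    have h1 : (R u, Z u) ∈ N.graph := (hG _ _).2 (congr($(hRZ.eq.symm) u))
    have h2 : (R u, B (Z u)) ∈ (T.pcomp N).graph :=
      (fp_mem_pcomp_graph _ _ _ _).2 ⟨_, h1, (hB _ _).2 rfl⟩
    obtain ⟨y, hy1, hy2⟩ := (fp_mem_pcomp_graph _ _ _ _).1 (LinearPMap.le_graph_of_le h h2)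
    rw [hB] at hy1
    subst hy1
    exact ((hF _ _).1 hy2).symm
  have hb := fp_bounded R Z S W B hR hS hZ hW hRZ hSW hid
  have hb1 : S * B * star Z * R = star W * B * R * R := by
    ext u
    have := congr($hb u)
    have h3 : S ((S * B * star Z * R) u - (star W * B * R * R) u) = 0 := by
      rw [_root_.map_sub, sub_eq_zero]; exact this
    exact sub_eq_zero.1 (hSi _ h3)
  have hb2 : Z * star B * S = R * star B * W := by
    have h4 := congrArg star hb1
    simp only [star_mul, star_star, hR.star_eq, hS.star_eq] at h4
    ext u
    have := congr($h4 u)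
    have h3 : R ((Z * star B * S) u - (R * star B * W) u) = 0 := by
      rw [_root_.map_sub, sub_eq_zero]
      simpa [mul_assoc] using this
    exact sub_eq_zero.1 (hRi _ h3)
  apply LinearPMap.le_of_le_graph
  rintro ⟨x, z⟩ hx
  obtain ⟨y, hy1, hy2⟩ := (fp_mem_pcomp_graph _ _ _ _).1 hx
  rw [hB] at hy2
  subst hy2
  refine (fp_mem_pcomp_graph _ _ _ _).2 ⟨B x, (hB _ _).2 rfl, (hFa _ _).2 ?_⟩
  apply ext_inner_left ℂ
  intro w
  have hg : (star B (S w), star B (W w)) ∈ N.graph := (hG _ _).2 (congr($hb2 w))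
  have hadj := (fp_adj hN.1 _ _).1 hy1 _ _ hg
  have hSs : inner ℂ w (S (B y)) = inner ℂ (S w) (B y) :=
    ((ContinuousLinearMap.isSelfAdjoint_iff_isSymmetric.mp hS) w (B y)).symm
  rw [hSs]
  have e1 : inner ℂ w ((star W) (B x)) = inner ℂ (W w) (B x) :=
    ContinuousLinearMap.adjoint_inner_right W w (B x)
  have e2 : ∀ u v, inner ℂ ((star B) u) v = inner ℂ u (B v) := fun u v =>
    ContinuousLinearMap.adjoint_inner_left B v u
  rw [e1, ← e2, ← e2, hadj]
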